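/- arXiv:math/0608680 — 10 statements merged into one kernel-verified Lean document; each statement's English description precedes it below -/
import Mathlib

section
/- Let X be a simple globular set and let x < y be consecutive elements in its total ordering (i.e., x < y and there is no z with x < z < y). Then x = ∂⁻y or ∂⁺x = y; moreover the dimensions of x and y differ by exactly 1. -/
/-- The data of a globular set: a dimension function together with
source (`src`) and target (`tgt`) operations. -/
structure GlobData where
  X : Type
  dim : X → ℕ
  src : X → X
  tgt : X → X

namespace GlobData

/-- The generating relation: `∂⁻y < y` (for `|y| > 0`) and `x < ∂⁺x` (for `|x| > 0`). -/
def rel (G : GlobData) (x y : G.X) : Prop :=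
  (0 < G.dim y ∧ x = G.src y) ∨ (0 < G.dim x ∧ y = G.tgt x)

/-- The transitive closure of the generating relation. -/
def lt (G : GlobData) : G.X → G.X → Prop :=
  Relation.TransGen G.rel

def le (G : GlobData) (x y : G.X) : Prop :=
  G.lt x y ∨ x = y

end GlobData

/-- A simple globular set: nonempty, finite, the source/target operations lower
dimension by one, the globular identities hold, and the transitive closure of the
generating relation is a (strict) total ordering. -/
def IsSimpleGlobular (G : GlobData) : Prop :=
  Nonempty G.X ∧ Finite G.X ∧
  (∀ x, 0 < G.dim x → G.dim (G.src x) + 1 = G.dim x) ∧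
  (∀ x, 0 < G.dim x → G.dim (G.tgt x) + 1 = G.dim x) ∧
  (∀ x, 2 ≤ G.dim x → G.src (G.src x) = G.src (G.tgt x)) ∧
  (∀ x, 2 ≤ G.dim x → G.tgt (G.src x) = G.tgt (G.tgt x)) ∧
  (∀ x, ¬ G.lt x x) ∧
  (∀ x y, G.lt x y ∨ x = y ∨ G.lt y x)

/-- Consecutive elements `x < y` in the total ordering of a simple globular set
satisfy `x = ∂⁻y` or `∂⁺x = y`, and their dimensions differ by exactly `1`. -/
theorem stmt0 (G : GlobData) (h : IsSimpleGlobular G) (x y : G.X)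
    (hxy : G.lt x y) (hcons : ∀ z, ¬ (G.lt x z ∧ G.lt z y)) :
    (x = G.src y ∨ y = G.tgt x) ∧
    (G.dim x + 1 = G.dim y ∨ G.dim y + 1 = G.dim x) := by
  obtain ⟨-, -, hsrc, htgt, -⟩ := h
  have hrel : G.rel x y := by
    rcases Relation.TransGen.head'_iff.1 hxy with ⟨z, hxz, hzy⟩
    rcases Relation.reflTransGen_iff_eq_or_transGen.1 hzy with rfl | hlt
    · exact hxz
    · exact (hcons z ⟨.single hxz, hlt⟩).elim
  rcases hrel with ⟨hy, rfl⟩ | ⟨hx, rfl⟩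
  · exact ⟨.inl rfl, .inl (hsrc y hy)⟩
  · exact ⟨.inr rfl, .inr (htgt x hx)⟩
end

section
/- Let X be a simple globular set with its total ordering, and let x ∈ X with |x| > 0. Then ∂⁻x is the last (|x|−1)-dimensional element before x (i.e., the greatest element y < x with |y| = |x| − 1), and ∂⁺x is the first (|x|−1)-dimensional element after x (i.e., the least element y > x with |y| = |x| − 1). -/
open Relation in
/-- Anything of dimension `n` lying below `b` lies below the iterated source of `b` of
dimension `n`. -/
theorem GlobData.reflTransGen_iterate_src (G : GlobData)
    (hsrc : ∀ x, 0 < G.dim x → G.dim (G.src x) + 1 = G.dim x)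
    (htgt : ∀ x, 0 < G.dim x → G.dim (G.tgt x) + 1 = G.dim x)
    (hglob : ∀ x, 2 ≤ G.dim x → G.src (G.src x) = G.src (G.tgt x))
    {y b : G.X} (hyb : ReflTransGen G.rel y b) (hdim : G.dim y ≤ G.dim b) :
    ReflTransGen G.rel y (G.src^[G.dim b - G.dim y] b) := by
  induction hyb with
  | refl => simpa using ReflTransGen.refl
  | @tail b c hyb hbc ih =>
    obtain hc | hc := hdim.eq_or_lt
    · simpa [hc] using hyb.tail hbc
    obtain ⟨hpos, rfl⟩ | ⟨hpos, rfl⟩ := hbc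
    · have hd := hsrc c hpos
      have e : G.dim c - G.dim y = G.dim (G.src c) - G.dim y + 1 := by omega
      rw [e, Function.iterate_succ_apply]
      exact ih (by omega)
    · have hd := htgt b hpos
      obtain ⟨k, hk⟩ := Nat.exists_eq_add_of_lt hc
      have e₁ : G.dim (G.tgt b) - G.dim y = k + 1 := by omega
      have e₂ : G.dim b - G.dim y = k + 1 + 1 := by omega
      have hb := ih (by omega)
      rw [e₂, Function.iterate_succ_apply, Function.iterate_succ_apply,
        hglob b (by omega)] at hb
      rwa [e₁, Function.iterate_succ_apply]

open Relation in
/-- Anything of dimension `n` lying above `b` lies above the iterated target of `b` of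
dimension `n`. -/
theorem GlobData.reflTransGen_iterate_tgt (G : GlobData)
    (hsrc : ∀ x, 0 < G.dim x → G.dim (G.src x) + 1 = G.dim x)
    (htgt : ∀ x, 0 < G.dim x → G.dim (G.tgt x) + 1 = G.dim x)
    (hglob : ∀ x, 2 ≤ G.dim x → G.tgt (G.src x) = G.tgt (G.tgt x))
    {b y : G.X} (hby : ReflTransGen G.rel b y) (hdim : G.dim y ≤ G.dim b) :
    ReflTransGen G.rel (G.tgt^[G.dim b - G.dim y] b) y := by
  induction hby using ReflTransGen.head_induction_on with
  | refl => simpa using ReflTransGen.refl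
  | @head b c hbc hcy ih =>
    obtain hb | hb := hdim.eq_or_lt
    · simpa [hb] using hcy.head hbc
    obtain ⟨hpos, rfl⟩ | ⟨hpos, rfl⟩ := hbc
    · have hd := hsrc c hpos
      obtain ⟨k, hk⟩ := Nat.exists_eq_add_of_lt hb
      have e₁ : G.dim (G.src c) - G.dim y = k + 1 := by omega
      have e₂ : G.dim c - G.dim y = k + 1 + 1 := by omega
      have hc := ih (by omega)
      rw [e₂, Function.iterate_succ_apply, Function.iterate_succ_apply,
        ← hglob c (by omega)] at hc
      rwa [e₁, Function.iterate_succ_apply]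
    · have hd := htgt b hpos
      have e : G.dim b - G.dim y = G.dim (G.tgt b) - G.dim y + 1 := by omega
      rw [e, Function.iterate_succ_apply]
      exact ih (by omega)

theorem GlobData.le_of_reflTransGen (G : GlobData) {x y : G.X}
    (h : Relation.ReflTransGen G.rel x y) : G.le x y :=
  (Relation.reflTransGen_iff_eq_or_transGen.1 h).elim (fun e => .inr e.symm) .inl


/-- In a simple globular set, `∂⁻x` is the last `(|x|-1)`-dimensional element
before `x`, and `∂⁺x` is the first `(|x|-1)`-dimensional element after `x`. -/
theorem stmt1 (G : GlobData) (h : IsSimpleGlobular G) (x : G.X) (hx : 0 < G.dim x) :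
    (G.lt (G.src x) x ∧ G.dim (G.src x) + 1 = G.dim x ∧
      ∀ y, G.lt y x → G.dim y + 1 = G.dim x → G.le y (G.src x)) ∧
    (G.lt x (G.tgt x) ∧ G.dim (G.tgt x) + 1 = G.dim x ∧
      ∀ y, G.lt x y → G.dim y + 1 = G.dim x → G.le (G.tgt x) y) := by
  obtain ⟨-, -, hsrc, htgt, hss, htt, -, -⟩ := h
  refine ⟨⟨.single (.inl ⟨hx, rfl⟩), hsrc x hx, fun y hy hd => ?_⟩,
    ⟨.single (.inr ⟨hx, rfl⟩), htgt x hx, fun y hy hd => ?_⟩⟩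
  · have hle := G.reflTransGen_iterate_src hsrc htgt hss hy.to_reflTransGen (by omega)
    rw [show G.dim x - G.dim y = 1 by omega] at hle
    exact G.le_of_reflTransGen hle
  · have hle := G.reflTransGen_iterate_tgt hsrc htgt htt hy.to_reflTransGen (by omega)
    rw [show G.dim x - G.dim y = 1 by omega] at hle
    exact G.le_of_reflTransGen hle
end

section
/- Let X be a simple globular set with its total ordering, let n ≥ 0, and let b ≤ x be elements of X such that every y with b ≤ y ≤ x satisfies |y| > n. Then the map y ↦ (∂⁻)^{|y|−n} y is constant on the interval {y ∈ X : b ≤ y ≤ x}. -/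
namespace GlobData

theorem le_iff_reflTransGen (G : GlobData) (x y : G.X) :
    G.le x y ↔ Relation.ReflTransGen G.rel x y := by
  rw [Relation.reflTransGen_iff_eq_or_transGen, le, lt, or_comm, eq_comm]

/-- Iterated sources in dimension `n` agree along a generating relation between elements of
dimension `> n`. -/
theorem iterate_src_eq_of_rel {G : GlobData} (h : IsSimpleGlobular G) {n : ℕ} {a c : G.X}
    (hac : G.rel a c) (ha : n < G.dim a) (hc : n < G.dim c) :
    G.src^[G.dim a - n] a = G.src^[G.dim c - n] c := by
  obtain ⟨-, -, hsrc, htgt, hss, -⟩ := h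
  rcases hac with ⟨hpos, rfl⟩ | ⟨hpos, rfl⟩
  · have hd := hsrc c hpos
    rw [show G.dim c - n = (G.dim (G.src c) - n) + 1 by omega, Function.iterate_succ_apply]
  · have hd := htgt a hpos
    obtain ⟨k, hk⟩ : ∃ k, G.dim (G.tgt a) - n = k + 1 := ⟨G.dim (G.tgt a) - n - 1, by omega⟩
    rw [hk, show G.dim a - n = k + 1 + 1 by omega, Function.iterate_succ_apply,
      Function.iterate_succ_apply, Function.iterate_succ_apply, hss a (by omega)]

/-- Iterated sources in dimension `n` agree at the ends of an interval all of whose elements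
have dimension `> n`. -/
theorem iterate_src_eq_of_le {G : GlobData} (h : IsSimpleGlobular G) {n : ℕ} {y z : G.X}
    (hyz : G.le y z) (hdim : ∀ w, G.le y w → G.le w z → n < G.dim w) :
    G.src^[G.dim y - n] y = G.src^[G.dim z - n] z := by
  simp only [le_iff_reflTransGen] at hyz hdim
  induction hyz with
  | refl => rfl
  | tail hya hac ih =>
    exact (ih fun w hyw hwa => hdim w hyw (hwa.tail hac)).trans
      (iterate_src_eq_of_rel h hac (hdim _ hya (.single hac)) (hdim _ (hya.tail hac) .refl))

end GlobData

/-- If every element of the interval `[b, x]` in a simple globular set has dimension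
`> n`, then `y ↦ (∂⁻)^{|y|-n} y` is constant on `[b, x]`. -/
theorem stmt2 (G : GlobData) (h : IsSimpleGlobular G) (n : ℕ) (b x : G.X)
    (hbx : G.le b x)
    (hdim : ∀ y, G.le b y → G.le y x → n < G.dim y) :
    ∀ y z, G.le b y → G.le y x → G.le b z → G.le z x →
      G.src^[G.dim y - n] y = G.src^[G.dim z - n] z := by
  have key : ∀ y z, G.le b y → G.le z x → G.le y z →
      G.src^[G.dim y - n] y = G.src^[G.dim z - n] z := by
    intro y z hby hzx hyz
    refine GlobData.iterate_src_eq_of_le h hyz fun w hyw hwz => hdim w ?_ ?_ <;>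
      rw [GlobData.le_iff_reflTransGen] at *
    · exact hby.trans hyw
    · exact hwz.trans hzx
  intro y z hby hyx hbz hzx
  obtain ⟨-, -, -, -, -, -, -, htotal⟩ := h
  rcases htotal y z with hyz | rfl | hzy
  · exact key y z hby hzx (.inl hyz)
  · rfl
  · exact (key z y hbz hyx (.inl hzy)).symm
end

section
/- Let X be a continuously graded ordered set. Then for every x ∈ X with |x| > 0 there exists a last (|x|−1)-dimensional element ∂⁻x before x and a first (|x|−1)-dimensional element ∂⁺x after x; with these operations X is a simple globular set, and the associated total ordering on X (the transitive closure of the relation generated by ∂⁻x < x and x < ∂⁺x) coincides with the given ordering of X. -/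
/-- In a finite continuously graded order whose first element has dimension 0, every `x` of
positive dimension has a preceding element of dimension `|x| - 1` such that everything strictly
between has dimension at least `|x|`. -/
theorem exists_lt_dim_succ_eq {X : Type*} [LinearOrder X] [Finite X] (dim : X → ℕ)
    (hfirst : ∀ x : X, (∀ y, x ≤ y) → dim x = 0)
    (hcons : ∀ x y : X, x ⋖ y → dim x + 1 = dim y ∨ dim y + 1 = dim x)
    (x : X) (hx : 0 < dim x) :
    ∃ s, s < x ∧ dim s + 1 = dim x ∧ ∀ y, s < y → y < x → dim x ≤ dim y := by
  have hne : {y | y < x ∧ dim y < dim x}.Nonempty := by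
    have : Nonempty X := ⟨x⟩
    obtain ⟨b, hb⟩ := Finite.exists_min (id : X → X)
    have hb0 := hfirst b hb
    refine ⟨b, lt_of_le_of_ne (hb x) ?_, by omega⟩
    rintro rfl
    omega
  obtain ⟨s, ⟨hsx, hsd⟩, hmax⟩ :=
    Set.exists_max_image _ id (Set.toFinite {y | y < x ∧ dim y < dim x}) hne
  have hbetween : ∀ y, s < y → y < x → dim x ≤ dim y := fun y hsy hyx =>
    not_lt.1 fun h => (hmax y ⟨hyx, h⟩).not_gt hsy
  refine ⟨s, hsx, ?_, hbetween⟩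
  obtain ⟨d, hsd', hdx⟩ := exists_covBy_le_of_lt hsx
  have hd : dim x ≤ dim d := by
    rcases hdx.lt_or_eq with h | rfl
    · exact hbetween d hsd'.lt h
    · exact le_rfl
  rcases hcons s d hsd' with h | h <;> omega

/-- A continuously graded ordered set is a simple globular set: `∂⁻x` exists as the
last `(|x|-1)`-dimensional element before `x`, `∂⁺x` as the first one after `x`,
these make `X` a simple globular set, and the associated total ordering coincides
with the given one. -/
theorem stmt3 (X : Type) [LinearOrder X] [Finite X] [Nonempty X] (dim : X → ℕ)
    (hfirst : ∀ x : X, (∀ y, x ≤ y) → dim x = 0)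
    (hlast : ∀ x : X, (∀ y, y ≤ x) → dim x = 0)
    (hcons : ∀ x y : X, x < y → (∀ z, ¬ (x < z ∧ z < y)) →
      dim x + 1 = dim y ∨ dim y + 1 = dim x) :
    ∃ src tgt : X → X,
      (∀ x, 0 < dim x →
        src x < x ∧ dim (src x) + 1 = dim x ∧
          ∀ y, y < x → dim y + 1 = dim x → y ≤ src x) ∧
      (∀ x, 0 < dim x →
        x < tgt x ∧ dim (tgt x) + 1 = dim x ∧
          ∀ y, x < y → dim y + 1 = dim x → tgt x ≤ y) ∧
      IsSimpleGlobular ⟨X, dim, src, tgt⟩ ∧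
      (∀ x y : X, GlobData.lt ⟨X, dim, src, tgt⟩ x y ↔ x < y) := by
  have hcov : ∀ x y : X, x ⋖ y → dim x + 1 = dim y ∨ dim y + 1 = dim x :=
    fun x y h => hcons x y h.lt fun z hz => h.2 hz.1 hz.2
  have hs := exists_lt_dim_succ_eq dim hfirst hcov
  have ht : ∀ x, 0 < dim x →
      ∃ t, x < t ∧ dim t + 1 = dim x ∧ ∀ y, y < t → x < y → dim x ≤ dim y :=
    exists_lt_dim_succ_eq (X := Xᵒᵈ) dim hlast fun x y h => (hcov y x h.ofDual).symm
  choose! src hsrc_lt hsrc_dim hsrc using hs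
  choose! tgt htgt_lt htgt_dim htgt using ht
  have hsrc_max : ∀ x, 0 < dim x → ∀ y, y < x → dim y + 1 = dim x → y ≤ src x := by
    intro x hx y hy hd
    by_contra! h
    have := hsrc x hx y h hy
    omega
  have htgt_min : ∀ x, 0 < dim x → ∀ y, x < y → dim y + 1 = dim x → tgt x ≤ y := by
    intro x hx y hy hd
    by_contra! h
    have := htgt x hx y h hy
    omega
  have hinside : ∀ x, 0 < dim x → ∀ y, src x ≤ y → y ≤ tgt x → dim x ≤ dim y + 1 := by
    intro x hx y h₁ h₂
    have := hsrc_dim x hx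
    have := htgt_dim x hx
    rcases h₁.eq_or_lt with rfl | h₁
    · omega
    rcases h₂.eq_or_lt with rfl | h₂
    · omega
    rcases lt_trichotomy y x with h | rfl | h
    · have := hsrc x hx y h₁ h
      omega
    · omega
    · have := htgt x hx y h₂ h
      omega
  have hlt : ∀ x y : X, GlobData.lt ⟨X, dim, src, tgt⟩ x y ↔ x < y := by
    intro x y
    constructor
    · intro h
      have hrel : ∀ a b : X, GlobData.rel ⟨X, dim, src, tgt⟩ a b → a < b := by
        rintro a b (⟨hb, rfl⟩ | ⟨ha, rfl⟩)
        · exact hsrc_lt b hb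
        · exact htgt_lt a ha
      exact Relation.transGen_minimal (r' := fun a b : X => a < b) hrel _ _ h
    · intro h
      have := Fintype.ofFinite X
      let := Fintype.toLocallyFiniteOrder (α := X)
      refine Relation.TransGen.mono (fun a b hab => ?_) _ _ (transGen_covBy_of_lt h)
      rcases hcov a b hab with hd | hd
      · have hb : 0 < dim b := by omega
        exact Or.inl ⟨hb, (hsrc_max b hb a hab.lt hd).eq_or_lt.resolve_right
          fun h' => hab.2 h' (hsrc_lt b hb)⟩
      · have ha : 0 < dim a := by omega
        exact Or.inr ⟨ha, ((htgt_min a ha b hab.lt hd).eq_or_lt.resolve_right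
          fun h' => hab.2 (htgt_lt a ha) h').symm⟩
  refine ⟨src, tgt, fun x hx => ⟨hsrc_lt x hx, hsrc_dim x hx, hsrc_max x hx⟩,
    fun x hx => ⟨htgt_lt x hx, htgt_dim x hx, htgt_min x hx⟩,
    ⟨‹_›, ‹_›, hsrc_dim, htgt_dim, fun x hx => ?_, fun x hx => ?_, fun x h => ?_, fun x y => ?_⟩,
    hlt⟩
  · change 2 ≤ dim x at hx
    change src (src x) = src (tgt x)
    have hx₀ : 0 < dim x := by omega
    have hds := hsrc_dim x hx₀
    have hdt := htgt_dim x hx₀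
    have hs₀ : 0 < dim (src x) := by omega
    have ht₀ : 0 < dim (tgt x) := by omega
    have hdss := hsrc_dim _ hs₀
    have hdst := hsrc_dim _ ht₀
    refine le_antisymm (hsrc_max _ ht₀ _ ?_ (by omega)) (hsrc_max _ hs₀ _ ?_ (by omega))
    · exact (hsrc_lt _ hs₀).trans ((hsrc_lt x hx₀).trans (htgt_lt x hx₀))
    · by_contra! h
      have := hinside x hx₀ _ h (hsrc_lt _ ht₀).le
      omega
  · change 2 ≤ dim x at hx
    change tgt (src x) = tgt (tgt x)
    have hx₀ : 0 < dim x := by omega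
    have hds := hsrc_dim x hx₀
    have hdt := htgt_dim x hx₀
    have hs₀ : 0 < dim (src x) := by omega
    have ht₀ : 0 < dim (tgt x) := by omega
    have hdts := htgt_dim _ hs₀
    have hdtt := htgt_dim _ ht₀
    refine le_antisymm (htgt_min _ hs₀ _ ?_ (by omega)) (htgt_min _ ht₀ _ ?_ (by omega))
    · exact (hsrc_lt x hx₀).trans ((htgt_lt x hx₀).trans (htgt_lt _ ht₀))
    · by_contra! h
      have := hinside x hx₀ _ (htgt_lt _ hs₀).le h
      omega
  · exact lt_irrefl _ ((hlt x x).1 h)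
  · rw [hlt, hlt]
    exact lt_trichotomy x y
end

section
/- Let X be a simple globular set with its total ordering. Then X, with its dimension function, is a continuously graded ordered set: the first and last elements of X have dimension 0, and any two consecutive elements have dimensions differing by 1. -/
/-- A simple globular set, with its total ordering and dimension function, is a
continuously graded ordered set: the first and last elements have dimension `0`,
and consecutive elements have dimensions differing by `1`. -/
theorem stmt4 (G : GlobData) (h : IsSimpleGlobular G) :
    (∀ x, (∀ y, G.le x y) → G.dim x = 0) ∧
    (∀ x, (∀ y, G.le y x) → G.dim x = 0) ∧
    (∀ x y, G.lt x y → (∀ z, ¬ (G.lt x z ∧ G.lt z y)) →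
      G.dim x + 1 = G.dim y ∨ G.dim y + 1 = G.dim x) := by
  obtain ⟨-, -, dim_src, dim_tgt, -, -, irrefl, -⟩ := h
  have not_le_of_rel : ∀ {x y}, G.rel x y → ¬ G.le y x := by
    rintro x y hxy (hyx | rfl)
    · exact irrefl x (.head hxy hyx)
    · exact irrefl y (.single hxy)
  refine ⟨fun x hx => ?_, fun x hx => ?_, fun x y hxy hcons => ?_⟩
  · by_contra hdim
    exact not_le_of_rel (.inl ⟨Nat.pos_of_ne_zero hdim, rfl⟩) (hx (G.src x))
  · by_contra hdim
    exact not_le_of_rel (.inr ⟨Nat.pos_of_ne_zero hdim, rfl⟩) (hx (G.tgt x))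
  · rcases Relation.TransGen.head'_iff.mp hxy with ⟨z, hxz, hzy⟩
    rcases Relation.reflTransGen_iff_eq_or_transGen.mp hzy with rfl | hzy
    · rcases hxz with ⟨hpos, rfl⟩ | ⟨hpos, rfl⟩
      · exact .inl (dim_src _ hpos)
      · exact .inr (dim_tgt _ hpos)
    · exact absurd ⟨.single hxz, hzy⟩ (hcons z)
end

section
/- Let S be the set of nonempty finite sequences (t_0, …, t_p) of nonnegative integers with t_0 = t_p = 0 and |t_i − t_{i−1}| = 1 for 1 ≤ i ≤ p. The map sending (t_0, …, t_p) to the subsequence consisting of its maxima (terms t_i such that no adjacent term equals t_i + 1) and its internal minima (terms t_i with 0 < i < p and t_{i−1} = t_{i+1} = t_i + 1) is a bijection from S onto the set of up-and-down vectors. -/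
/-- Membership in `S`: a nonempty finite sequence of nonnegative integers beginning
and ending with `0` whose adjacent terms differ by `1`. -/
def Sseq (l : List ℕ) : Prop :=
  l ≠ [] ∧ l.getD 0 0 = 0 ∧ l.getD (l.length - 1) 0 = 0 ∧
  ∀ i, i + 1 < l.length →
    l.getD i 0 + 1 = l.getD (i + 1) 0 ∨ l.getD (i + 1) 0 + 1 = l.getD i 0

/-- An up-and-down vector `(u_0, v_1, u_1, …, v_k, u_k)`: odd length, with
`u_{i-1} > v_i` and `v_i < u_i`. -/
def UpDown (l : List ℕ) : Prop :=
  l.length % 2 = 1 ∧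
  ∀ i, 2 * i + 2 < l.length →
    l.getD (2 * i + 1) 0 < l.getD (2 * i) 0 ∧
    l.getD (2 * i + 1) 0 < l.getD (2 * i + 2) 0

/-- Index `i` of `l` is kept: it is a maximum (no adjacent term equals `t_i + 1`)
or an internal minimum (`0 < i < p` and `t_{i-1} = t_{i+1} = t_i + 1`). -/
def keep (l : List ℕ) (i : ℕ) : Bool :=
  ((!(decide (0 < i) && decide (l.getD (i - 1) 0 = l.getD i 0 + 1))) &&
   (!(decide (i + 1 < l.length) && decide (l.getD (i + 1) 0 = l.getD i 0 + 1)))) ||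
  (decide (0 < i) && decide (i + 1 < l.length) &&
   decide (l.getD (i - 1) 0 = l.getD i 0 + 1) &&
   decide (l.getD (i + 1) 0 = l.getD i 0 + 1))

/-- The subsequence consisting of the maxima and the internal minima. -/
def udMap (l : List ℕ) : List ℕ :=
  ((List.range l.length).filter (keep l)).map fun i => l.getD i 0

/-- `a :: r` changes by `1` at each step and ends with `0`. -/
def StepsToZero : ℕ → List ℕ → Prop
  | a, [] => a = 0
  | a, b :: r => (a + 1 = b ∨ b + 1 = a) ∧ StepsToZero b r

/-- The maxima and internal minima of `a :: r`, where `d` records whether the sequence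
arrives at `a` from `a + 1`. -/
def extrema : Bool → ℕ → List ℕ → List ℕ
  | d, a, [] => if d then [] else [a]
  | d, a, b :: r =>
    if d = decide (b = a + 1) then a :: extrema (decide (a = b + 1)) b r
    else extrema (decide (a = b + 1)) b r

/-- The list alternates between maxima and minima, ending with a maximum. It starts with a
maximum that is at least `a` if `d` is false, and is empty or starts with a minimum that is
less than `a` if `d` is true. -/
def Alternates : Bool → ℕ → List ℕ → Prop
  | d, _, [] => d = true
  | false, a, u :: l => a ≤ u ∧ Alternates true u l
  | true, a, v :: l => v < a ∧ Alternates false (v + 1) l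

theorem stepsToZero_iff (a : ℕ) (r : List ℕ) :
    StepsToZero a r ↔ (a :: r).getD r.length 0 = 0 ∧
      ∀ i, i + 1 < (a :: r).length →
        (a :: r).getD i 0 + 1 = (a :: r).getD (i + 1) 0 ∨
        (a :: r).getD (i + 1) 0 + 1 = (a :: r).getD i 0 := by
  induction r generalizing a with
  | nil => simp [StepsToZero]
  | cons b r ih =>
    rw [StepsToZero, ih b]
    constructor
    · rintro ⟨h, h0, hs⟩
      refine ⟨by simpa using h0, fun i hi => ?_⟩
      cases i with
      | zero => simpa using h
      | succ i => simpa using hs i (by simpa using hi)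
    · rintro ⟨h0, hs⟩
      exact ⟨by simpa using hs 0 (by simp), by simpa using h0,
        fun i hi => by simpa using hs (i + 1) (by simpa using hi)⟩

theorem sseq_iff (l : List ℕ) : Sseq l ↔ ∃ r, l = 0 :: r ∧ StepsToZero 0 r := by
  cases l with
  | nil => simp [Sseq]
  | cons a r =>
    constructor
    · rintro ⟨-, h0, h1, hs⟩
      obtain rfl : a = 0 := by simpa using h0
      exact ⟨r, rfl, (stepsToZero_iff 0 r).2 ⟨by simpa using h1, hs⟩⟩
    · rintro ⟨r', h, hr⟩
      obtain ⟨rfl, rfl⟩ := List.cons.inj h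
      obtain ⟨h1, hs⟩ := (stepsToZero_iff 0 r).1 hr
      exact ⟨by simp, by simp, by simpa using h1, hs⟩

theorem upDown_cons_cons_cons (u v w : ℕ) (l : List ℕ) :
    UpDown (u :: v :: w :: l) ↔ v < u ∧ v < w ∧ UpDown (w :: l) := by
  constructor
  · rintro ⟨hl, h⟩
    have h0 := h 0 (by simp)
    refine ⟨by simpa using h0.1, by simpa using h0.2, ?_, fun i hi => ?_⟩
    · simp only [List.length_cons] at hl ⊢
      omega
    · simpa [Nat.mul_add] using h (i + 1) (by simp only [List.length_cons] at hi ⊢; omega)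
  · rintro ⟨h1, h2, hl, h⟩
    refine ⟨by simp only [List.length_cons] at hl ⊢; omega, fun i hi => ?_⟩
    cases i with
    | zero => simpa using ⟨h1, h2⟩
    | succ i =>
      simpa [Nat.mul_add] using h i (by simp only [List.length_cons] at hi ⊢; omega)

theorem upDown_cons_iff : ∀ (u : ℕ) (l : List ℕ), UpDown (u :: l) ↔ Alternates true u l
  | u, [] => by simp [UpDown, Alternates]
  | u, [v] => by simp [UpDown, Alternates]
  | u, v :: w :: l => by
    rw [upDown_cons_cons_cons, upDown_cons_iff w l]
    simp [Alternates]

theorem upDown_iff (l : List ℕ) : UpDown l ↔ Alternates false 0 l := by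
  cases l with
  | nil => simp [UpDown, Alternates]
  | cons u l => simp [upDown_cons_iff, Alternates]

theorem map_filter_keep_append (p : List ℕ) (a : ℕ) (r : List ℕ) :
    ((List.range' p.length (r.length + 1)).filter (keep (p ++ a :: r))).map
        (fun i => (p ++ a :: r).getD i 0) =
      extrema (decide (0 < p.length ∧ p.getD (p.length - 1) 0 = a + 1)) a r := by
  induction r generalizing p a with
  | nil =>
    have hk : keep (p ++ [a]) p.length =
        !decide (0 < p.length ∧ p.getD (p.length - 1) 0 = a + 1) := by
      grind [keep]
    rw [extrema, List.length_nil, List.range'_one, List.filter_singleton, hk]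
    cases decide (0 < p.length ∧ p.getD (p.length - 1) 0 = a + 1) <;> simp
  | cons b r ih =>
    have hk : keep (p ++ a :: b :: r) p.length =
        decide (decide (0 < p.length ∧ p.getD (p.length - 1) 0 = a + 1) =
          decide (b = a + 1)) := by
      grind [keep]
    have := ih (p ++ [a]) b
    simp only [List.append_assoc, List.singleton_append, List.length_append,
      List.length_singleton] at this
    rw [List.length_cons, List.range'_succ, List.filter_cons, hk, extrema]
    have hd : decide (0 < p.length + 1 ∧ (p ++ [a]).getD (p.length + 1 - 1) 0 = b + 1) =
        decide (a = b + 1) := by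
      simp
    rw [hd] at this
    simp only [decide_eq_true_eq]
    rw [← this]
    split_ifs <;> simp

theorem udMap_cons (a : ℕ) (r : List ℕ) : udMap (a :: r) = extrema false a r := by
  simpa [udMap, List.range_eq_range'] using map_filter_keep_append [] a r

@[simp]
theorem extrema_cons_succ (d : Bool) (a : ℕ) (r : List ℕ) :
    extrema d a ((a + 1) :: r) =
      if d then a :: extrema false (a + 1) r else extrema false (a + 1) r := by
  have : a ≠ a + 1 + 1 := by omega
  simp [extrema, this]

@[simp]
theorem extrema_succ_cons (d : Bool) (a : ℕ) (r : List ℕ) :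
    extrema d (a + 1) (a :: r) =
      if d then extrema true a r else (a + 1) :: extrema true a r := by
  have : a ≠ a + 1 + 1 := by omega
  cases d <;> simp [extrema, this]

theorem alternates_extrema (d : Bool) (a : ℕ) (r : List ℕ) (h : StepsToZero a r) :
    Alternates d (a + d.toNat) (extrema d a r) := by
  induction r generalizing d a with
  | nil => cases d <;> simp [extrema, Alternates]
  | cons b r ih =>
    obtain ⟨rfl | rfl, hr⟩ := h
    · have := ih false (a + 1) hr
      generalize he : extrema false (a + 1) r = l at this
      cases d <;> cases l <;> simp_all [Alternates]
      omega
    · have := ih true b hr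
      generalize he : extrema true b r = l at this
      cases d <;> cases l <;> simp_all [Alternates]
      omega

theorem extrema_injOn (d : Bool) (a : ℕ) : Set.InjOn (extrema d a) {r | StepsToZero a r} := by
  have extrema_ne_up (d : Bool) (a : ℕ) (r : List ℕ) (hr : StepsToZero (a + 1) r)
      (l : List ℕ) (hl : d = true → Alternates true a l) :
      extrema d a ((a + 1) :: r) ≠ if d then l else a :: l := by
    have := alternates_extrema false (a + 1) r hr
    cases d <;> cases l <;> grind [extrema, Alternates]
  intro r hr s hs h
  simp only [Set.mem_ofPred_eq] at hr hs
  induction r generalizing d a s with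
  | nil =>
    cases s with
    | nil => rfl
    | cons c s =>
      obtain rfl : a = 0 := hr
      obtain ⟨rfl | hc, hs⟩ := hs
      · exact absurd h.symm (extrema_ne_up d 0 s hs [] (by simp [Alternates]))
      · omega
  | cons b r ih =>
    cases s with
    | nil =>
      obtain rfl : a = 0 := hs
      obtain ⟨rfl | hb, hr⟩ := hr
      · exact absurd h (extrema_ne_up d 0 r hr [] (by simp [Alternates]))
      · omega
    | cons c s =>
      obtain ⟨hb, hr⟩ := hr
      obtain ⟨hc, hs⟩ := hs
      have down (e : ℕ) (t : List ℕ) : e + 1 = a →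
          extrema d a (e :: t) = if d then extrema true e t else a :: extrema true e t := by
        rintro rfl
        simp
      by_cases hbc : b = c
      · subst hbc
        have : extrema (decide (a = b + 1)) b r = extrema (decide (a = b + 1)) b s := by
          simp only [extrema] at h
          split_ifs at h
          · exact (List.cons.inj h).2
          · exact h
        rw [ih _ b hr hs this]
      · exfalso
        rcases hb with rfl | hb
        · have hc : c + 1 = a := by omega
          rw [down c s hc] at h
          exact extrema_ne_up d a r hr _
            (fun _ => by simpa [hc] using alternates_extrema true c s hs) h
        · obtain rfl : c = a + 1 := by omega
          rw [down b r hb] at h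
          exact extrema_ne_up d a s hs _
            (fun _ => by simpa [hb] using alternates_extrema true b r hr) h.symm

theorem exists_extrema_eq (d : Bool) (a : ℕ) (l : List ℕ) (h : Alternates d (a + d.toNat) l) :
    ∃ r, StepsToZero a r ∧ extrema d a r = l := by
  induction l generalizing d a with
  | nil =>
    obtain rfl : d = true := by simpa [Alternates] using h
    clear h
    induction a with
    | zero => exact ⟨[], by simp [StepsToZero, extrema]⟩
    | succ a ih =>
      obtain ⟨r, hr, he⟩ := ih
      exact ⟨a :: r, by simp [StepsToZero, hr, he]⟩
  | cons x l ih =>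
    cases d
    · obtain ⟨hx, hl⟩ : a ≤ x ∧ Alternates true x l := by simpa [Alternates] using h
      clear h
      induction hx using Nat.decreasingInduction with
      | self =>
        cases x with
        | zero =>
          cases l with
          | nil => exact ⟨[], by simp [StepsToZero, extrema]⟩
          | cons v l => simp [Alternates] at hl
        | succ x =>
          obtain ⟨r, hr, he⟩ := ih true x hl
          exact ⟨x :: r, by simp [StepsToZero, hr, he]⟩
      | of_succ a _ iha =>
        obtain ⟨r, hr, he⟩ := iha
        exact ⟨(a + 1) :: r, by simp [StepsToZero, hr, he]⟩
    · obtain ⟨hx, hl⟩ : x ≤ a ∧ Alternates false (x + 1) l := by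
        simpa [Alternates, Nat.lt_succ_iff] using h
      clear h
      induction hx with
      | refl =>
        obtain ⟨r, hr, he⟩ := ih false (x + 1) hl
        exact ⟨(x + 1) :: r, by simp [StepsToZero, hr, he]⟩
      | @step m _ iha =>
        obtain ⟨r, hr, he⟩ := iha
        exact ⟨m :: r, by simp [StepsToZero, hr, he]⟩

/-- The map sending a sequence to the subsequence of its maxima and internal minima
is a bijection from `S` onto the set of up-and-down vectors. -/
theorem stmt5 : Set.BijOn udMap {l | Sseq l} {l | UpDown l} := by
  refine ⟨fun l hl => ?_, fun l hl m hm h => ?_, fun l hl => ?_⟩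
  · obtain ⟨r, rfl, hr⟩ := (sseq_iff l).1 hl
    rw [Set.mem_ofPred_eq, upDown_iff, udMap_cons]
    exact alternates_extrema false 0 r hr
  · obtain ⟨r, rfl, hr⟩ := (sseq_iff l).1 hl
    obtain ⟨s, rfl, hs⟩ := (sseq_iff m).1 hm
    rw [udMap_cons, udMap_cons] at h
    rw [extrema_injOn false 0 hr hs h]
  · obtain ⟨r, hr, he⟩ := exists_extrema_eq false 0 l ((upDown_iff l).1 hl)
    exact ⟨0 :: r, (sseq_iff _).2 ⟨r, rfl, hr⟩, by rw [udMap_cons, he]⟩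
end

section
/- Let K be a simple augmented directed complex. Then for every basis element b and each sign α ∈ {−, +}, the chain (∂^α)^{|b|} b is a single 0-dimensional basis element; in particular ε((∂⁻)^{|b|} b) = ε((∂⁺)^{|b|} b) = 1, i.e., the basis of K is unital. -/
/-- The data of an augmented directed complex with basis: a graded set `B` of basis
elements, the boundary `d b` of each basis element (a finitely supported `ℤ`-linear
combination of basis elements), and the augmentation `eps b` of each basis element
(only relevant in dimension `0`).  The chain group `K_q` is the free abelian group
on the basis elements of dimension `q` and the distinguished submonoid `K_q*` is the
set of nonnegative combinations of such basis elements. -/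
structure PreADC where
  B : Type
  dim : B → ℕ
  d : B → (B →₀ ℤ)
  eps : B → ℤ

namespace PreADC

/-- The positive part `∂⁺x` of a chain. -/
noncomputable def posPart {B : Type} (x : B →₀ ℤ) : B →₀ ℤ :=
  Finsupp.mapRange (fun c => max c 0) (by simp) x

/-- The negative part `∂⁻x` of a chain. -/
noncomputable def negPart {B : Type} (x : B →₀ ℤ) : B →₀ ℤ :=
  Finsupp.mapRange (fun c => max (-c) 0) (by simp) x

/-- The boundary of a chain, extended linearly from basis elements. -/
noncomputable def bnd (K : PreADC) (x : K.B →₀ ℤ) : K.B →₀ ℤ :=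
  x.sum fun a c => c • K.d a

/-- The augmentation of a chain (applied to its degree-zero part). -/
noncomputable def aug (K : PreADC) (x : K.B →₀ ℤ) : ℤ :=
  x.sum fun a c => if K.dim a = 0 then c * K.eps a else 0

/-- `∂⁻` of a chain. -/
noncomputable def dMinus (K : PreADC) (x : K.B →₀ ℤ) : K.B →₀ ℤ :=
  negPart (K.bnd x)

/-- `∂⁺` of a chain. -/
noncomputable def dPlus (K : PreADC) (x : K.B →₀ ℤ) : K.B →₀ ℤ :=
  posPart (K.bnd x)

/-- The axioms of an augmented directed complex with basis: the boundary of a basis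
element lowers dimension by exactly one (and vanishes in dimension `0`), `∂∂ = 0`,
and `ε∂ = 0`. -/
def IsADC (K : PreADC) : Prop :=
  (∀ b, K.dim b = 0 → K.d b = 0) ∧
  (∀ b a, (K.d b) a ≠ 0 → K.dim a + 1 = K.dim b) ∧
  (∀ b, K.bnd (K.d b) = 0) ∧
  (∀ b, K.dim b = 1 → K.aug (K.d b) = 0)

/-- The basis is unital: `ε((∂⁻)^{|b|} b) = ε((∂⁺)^{|b|} b) = 1` for all basis elements. -/
def Unital (K : PreADC) : Prop :=
  ∀ b : K.B,
    K.aug ((K.dMinus)^[K.dim b] (Finsupp.single b 1)) = 1 ∧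
    K.aug ((K.dPlus)^[K.dim b] (Finsupp.single b 1)) = 1

/-- The basis is loop-free: for each `q` there is a (strict) partial ordering `r`
such that `a r b` whenever `a` is a term of `(∂⁻)^{|b|-q} b` with `|b| > q`, or `b`
is a term of `(∂⁺)^{|a|-q} a` with `|a| > q`. -/
def LoopFree (K : PreADC) : Prop :=
  ∀ q : ℕ, ∃ r : K.B → K.B → Prop,
    (∀ a b c, r a b → r b c → r a c) ∧ (∀ a, ¬ r a a) ∧
    (∀ a b, q < K.dim b → ((K.dMinus)^[K.dim b - q] (Finsupp.single b 1)) a ≠ 0 → r a b) ∧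
    (∀ a b, q < K.dim a → ((K.dPlus)^[K.dim a - q] (Finsupp.single a 1)) b ≠ 0 → r a b)

/-- The basis is strongly loop-free: there is a (strict) partial ordering `r` on the
whole basis such that `a r b` whenever `a` is a term of `∂⁻b` or `b` is a term of `∂⁺a`. -/
def StronglyLoopFree (K : PreADC) : Prop :=
  ∃ r : K.B → K.B → Prop,
    (∀ a b c, r a b → r b c → r a c) ∧ (∀ a, ¬ r a a) ∧
    (∀ a b, (negPart (K.d b)) a ≠ 0 → r a b) ∧
    (∀ a b, (posPart (K.d a)) b ≠ 0 → r a b)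

/-- `f` (given by its values on basis elements, extended linearly) is a chain map
preserving the grading and taking sums of basis elements to sums of basis elements
(equivalently `f(K_q*) ⊆ L_q*`). -/
def IsMor (K L : PreADC) (f : K.B → (L.B →₀ ℤ)) : Prop :=
  (∀ b a, (f b) a ≠ 0 → L.dim a = K.dim b) ∧
  (∀ b, ((K.d b).sum fun a c => c • f a) = L.bnd (f b)) ∧
  (∀ b a, 0 ≤ (f b) a)

/-- A morphism of augmented directed complexes: a chain map as in `IsMor` which is
moreover augmentation-preserving. -/
def IsAugMor (K L : PreADC) (f : K.B → (L.B →₀ ℤ)) : Prop :=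
  IsMor K L f ∧ ∀ b, K.dim b = 0 → L.aug (f b) = K.eps b

end PreADC

/-- The simple augmented directed complex generated by a (simple) globular set:
basis the elements of `X`, `∂x = ∂⁺x - ∂⁻x` for positive-dimensional `x`,
and `εx = 1` on zero-dimensional basis elements. -/
noncomputable def GlobData.toADC (G : GlobData) : PreADC where
  B := G.X
  dim := G.dim
  d := fun b =>
    if 0 < G.dim b then
      Finsupp.single (G.tgt b) 1 - Finsupp.single (G.src b) 1
    else 0
  eps := fun _ => 1

namespace PreADC

theorem posPart_single_sub_single {B : Type} {s t : B} (h : s ≠ t) :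
    posPart (Finsupp.single t 1 - Finsupp.single s 1) = Finsupp.single t 1 := by
  classical
  ext a
  simp only [posPart, Finsupp.mapRange_apply, Finsupp.sub_apply, Finsupp.single_apply]
  split_ifs <;> simp_all

theorem negPart_single_sub_single {B : Type} {s t : B} (h : s ≠ t) :
    negPart (Finsupp.single t 1 - Finsupp.single s 1) = Finsupp.single s 1 := by
  classical
  ext a
  simp only [negPart, Finsupp.mapRange_apply, Finsupp.sub_apply, Finsupp.single_apply]
  split_ifs <;> simp_all

theorem bnd_single (K : PreADC) (b : K.B) : K.bnd (Finsupp.single b 1) = K.d b := by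
  simp [bnd]

theorem aug_single (K : PreADC) {a : K.B} (ha : K.dim a = 0) :
    K.aug (Finsupp.single a 1) = K.eps a := by
  simp [aug, ha]

/-- If an operator on chains sends each positive-dimensional basis element to a single basis
element of one dimension lower, then iterating it `|b|` times on a basis element `b` gives
a single basis element of dimension zero. -/
theorem exists_iterate_eq_single (K : PreADC) (D : (K.B →₀ ℤ) → (K.B →₀ ℤ)) (f : K.B → K.B)
    (hdim : ∀ b, 0 < K.dim b → K.dim (f b) + 1 = K.dim b)
    (hD : ∀ b, 0 < K.dim b → D (Finsupp.single b 1) = Finsupp.single (f b) 1) (b : K.B) :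
    ∃ a, K.dim a = 0 ∧ D^[K.dim b] (Finsupp.single b 1) = Finsupp.single a 1 := by
  induction hn : K.dim b generalizing b with
  | zero => exact ⟨b, hn, rfl⟩
  | succ n ih =>
    have hb : 0 < K.dim b := by omega
    have hf : K.dim (f b) = n := by have := hdim b hb; omega
    rw [Function.iterate_succ_apply, hD b hb]
    exact ih (f b) hf

end PreADC

namespace GlobData

theorem src_ne_tgt (G : GlobData) (hirr : ∀ x, ¬ G.lt x x) {b : G.X} (hb : 0 < G.dim b) :
    G.src b ≠ G.tgt b := fun he =>
  hirr b (.tail (.single (Or.inr ⟨hb, rfl⟩)) (Or.inl ⟨hb, he.symm⟩))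

theorem bnd_toADC_single (G : GlobData) {b : G.X} (hb : 0 < G.dim b) :
    G.toADC.bnd (Finsupp.single b 1) =
      (Finsupp.single (G.tgt b) 1 - Finsupp.single (G.src b) 1 : G.X →₀ ℤ) :=
  (PreADC.bnd_single G.toADC b).trans (if_pos hb)

theorem dMinus_toADC_single (G : GlobData) (hirr : ∀ x, ¬ G.lt x x) {b : G.X}
    (hb : 0 < G.dim b) :
    G.toADC.dMinus (Finsupp.single b 1) = (Finsupp.single (G.src b) 1 : G.X →₀ ℤ) :=
  (congrArg PreADC.negPart (G.bnd_toADC_single hb)).trans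
    (PreADC.negPart_single_sub_single (G.src_ne_tgt hirr hb))

theorem dPlus_toADC_single (G : GlobData) (hirr : ∀ x, ¬ G.lt x x) {b : G.X}
    (hb : 0 < G.dim b) :
    G.toADC.dPlus (Finsupp.single b 1) = (Finsupp.single (G.tgt b) 1 : G.X →₀ ℤ) :=
  (congrArg PreADC.posPart (G.bnd_toADC_single hb)).trans
    (PreADC.posPart_single_sub_single (G.src_ne_tgt hirr hb))

end GlobData

/-- In a simple augmented directed complex, `(∂^α)^{|b|} b` is a single
zero-dimensional basis element for each basis element `b` and each sign `α`;
in particular the basis is unital. -/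
theorem stmt6 (G : GlobData) (h : IsSimpleGlobular G) :
    (∀ b : G.X,
      (∃ a : G.X, G.dim a = 0 ∧
        (G.toADC.dMinus)^[G.dim b] (Finsupp.single b 1) = Finsupp.single a 1) ∧
      (∃ a : G.X, G.dim a = 0 ∧
        (G.toADC.dPlus)^[G.dim b] (Finsupp.single b 1) = Finsupp.single a 1)) ∧
    PreADC.Unital G.toADC := by
  obtain ⟨-, -, hsrc, htgt, -, -, hirr, -⟩ := h
  have hminus := G.toADC.exists_iterate_eq_single G.toADC.dMinus G.src hsrc
    fun _ hb => G.dMinus_toADC_single hirr hb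
  have hplus := G.toADC.exists_iterate_eq_single G.toADC.dPlus G.tgt htgt
    fun _ hb => G.dPlus_toADC_single hirr hb
  refine ⟨fun b => ⟨hminus b, hplus b⟩, fun b => ⟨?_, ?_⟩⟩
  · obtain ⟨a, ha, e⟩ := hminus b
    rw [e, G.toADC.aug_single ha]
    rfl
  · obtain ⟨a, ha, e⟩ := hplus b
    rw [e, G.toADC.aug_single ha]
    rfl
end

section
/- Let K be an augmented directed complex with a strongly loop-free basis, witnessed by a partial ordering <_ℕ on the basis. Then for every q ≥ 0 and all basis elements a, b: if |b| > q and a is a term of (∂⁻)^{|b|−q} b, then a <_ℕ b; and if |a| > q and b is a term of (∂⁺)^{|a|−q} a, then a <_ℕ b. Consequently the basis of K is loop-free, with the restrictions of <_ℕ serving as the partial orderings <_q. -/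
namespace PreADC

theorem bnd_apply (K : PreADC) (x : K.B →₀ ℤ) (a : K.B) :
    K.bnd x a = ∑ c ∈ x.support, x c * K.d c a := by
  simp [bnd, Finsupp.sum, Finsupp.finsetSum_apply]

theorem negPart_ne_zero_iff {B : Type} (x : B →₀ ℤ) (a : B) : negPart x a ≠ 0 ↔ x a < 0 := by
  simp only [negPart, Finsupp.mapRange_apply]
  omega

theorem posPart_ne_zero_iff {B : Type} (x : B →₀ ℤ) (a : B) : posPart x a ≠ 0 ↔ 0 < x a := by
  simp only [posPart, Finsupp.mapRange_apply]
  omega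

/-- A term of `∂⁻x`, for `x` a sum of basis elements, is a term of `∂⁻c` for some term `c`
of `x`. -/
theorem exists_term_of_dMinus_ne_zero (K : PreADC) {x : K.B →₀ ℤ} (hx : ∀ c, 0 ≤ x c) {a : K.B}
    (ha : K.dMinus x a ≠ 0) : ∃ c, x c ≠ 0 ∧ negPart (K.d c) a ≠ 0 := by
  simp only [dMinus, negPart_ne_zero_iff, bnd_apply] at ha ⊢
  by_contra! h
  exact ha.not_ge (Finset.sum_nonneg fun c hc =>
    mul_nonneg (hx c) (h c (Finsupp.mem_support_iff.mp hc)))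

/-- A term of `∂⁺x`, for `x` a sum of basis elements, is a term of `∂⁺c` for some term `c`
of `x`. -/
theorem exists_term_of_dPlus_ne_zero (K : PreADC) {x : K.B →₀ ℤ} (hx : ∀ c, 0 ≤ x c) {a : K.B}
    (ha : K.dPlus x a ≠ 0) : ∃ c, x c ≠ 0 ∧ posPart (K.d c) a ≠ 0 := by
  simp only [dPlus, posPart_ne_zero_iff, bnd_apply] at ha ⊢
  by_contra! h
  exact ha.not_ge (Finset.sum_nonpos fun c hc =>
    mul_nonpos_of_nonneg_of_nonpos (hx c) (h c (Finsupp.mem_support_iff.mp hc)))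

theorem single_one_nonneg {B : Type} (b c : B) : 0 ≤ (Finsupp.single b (1 : ℤ)) c := by
  classical
  rw [Finsupp.single_apply]
  split_ifs <;> simp

theorem iterate_dMinus_single_nonneg (K : PreADC) (b : K.B) (n : ℕ) (c : K.B) :
    0 ≤ (K.dMinus)^[n] (Finsupp.single b 1) c := by
  cases n with
  | zero => exact single_one_nonneg b c
  | succ n =>
    rw [Function.iterate_succ_apply']
    exact le_max_right _ _

theorem iterate_dPlus_single_nonneg (K : PreADC) (b : K.B) (n : ℕ) (c : K.B) :
    0 ≤ (K.dPlus)^[n] (Finsupp.single b 1) c := by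
  cases n with
  | zero => exact single_one_nonneg b c
  | succ n =>
    rw [Function.iterate_succ_apply']
    exact le_max_right _ _

theorem rel_of_iterate_dMinus_ne_zero (K : PreADC) {r : K.B → K.B → Prop}
    (htrans : ∀ a b c, r a b → r b c → r a c)
    (hminus : ∀ a b, negPart (K.d b) a ≠ 0 → r a b) (b : K.B) (n : ℕ) (a : K.B)
    (ha : (K.dMinus)^[n + 1] (Finsupp.single b 1) a ≠ 0) : r a b := by
  induction n generalizing a with
  | zero =>
    obtain ⟨c, hc, hac⟩ := K.exists_term_of_dMinus_ne_zero (single_one_nonneg b) ha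
    obtain rfl : b = c := by
      by_contra hbc
      exact hc (Finsupp.single_eq_of_ne' hbc)
    exact hminus a b hac
  | succ n ih =>
    rw [Function.iterate_succ_apply'] at ha
    obtain ⟨c, hc, hac⟩ :=
      K.exists_term_of_dMinus_ne_zero (K.iterate_dMinus_single_nonneg b (n + 1)) ha
    exact htrans a c b (hminus a c hac) (ih c hc)

theorem rel_of_iterate_dPlus_ne_zero (K : PreADC) {r : K.B → K.B → Prop}
    (htrans : ∀ a b c, r a b → r b c → r a c)
    (hplus : ∀ a b, posPart (K.d a) b ≠ 0 → r a b) (a : K.B) (n : ℕ) (b : K.B)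
    (hb : (K.dPlus)^[n + 1] (Finsupp.single a 1) b ≠ 0) : r a b := by
  induction n generalizing b with
  | zero =>
    obtain ⟨c, hc, hcb⟩ := K.exists_term_of_dPlus_ne_zero (single_one_nonneg a) hb
    obtain rfl : a = c := by
      by_contra hac
      exact hc (Finsupp.single_eq_of_ne' hac)
    exact hplus a b hcb
  | succ n ih =>
    rw [Function.iterate_succ_apply'] at hb
    obtain ⟨c, hc, hcb⟩ :=
      K.exists_term_of_dPlus_ne_zero (K.iterate_dPlus_single_nonneg a (n + 1)) hb
    exact htrans a c b (ih c hc) (hplus c b hcb)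

end PreADC

/-- If the basis of `K` is strongly loop-free, witnessed by `r`, then for all `q`:
if `|b| > q` and `a` is a term of `(∂⁻)^{|b|-q} b` then `a r b`, and if `|a| > q`
and `b` is a term of `(∂⁺)^{|a|-q} a` then `a r b`; consequently the basis is
loop-free, with the restrictions of `r` serving as the orderings `<_q`. -/
theorem stmt7 (K : PreADC) (hK : PreADC.IsADC K)
    (r : K.B → K.B → Prop)
    (htrans : ∀ a b c, r a b → r b c → r a c) (hirr : ∀ a, ¬ r a a)
    (hminus : ∀ a b, (PreADC.negPart (K.d b)) a ≠ 0 → r a b)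
    (hplus : ∀ a b, (PreADC.posPart (K.d a)) b ≠ 0 → r a b) :
    ((∀ (q : ℕ) (a b : K.B), q < K.dim b →
        ((K.dMinus)^[K.dim b - q] (Finsupp.single b 1)) a ≠ 0 → r a b) ∧
     (∀ (q : ℕ) (a b : K.B), q < K.dim a →
        ((K.dPlus)^[K.dim a - q] (Finsupp.single a 1)) b ≠ 0 → r a b)) ∧
    PreADC.LoopFree K := by
  have hm (q : ℕ) (a b : K.B) (hq : q < K.dim b)
      (h : ((K.dMinus)^[K.dim b - q] (Finsupp.single b 1)) a ≠ 0) : r a b := by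
    obtain ⟨n, hn⟩ := Nat.exists_eq_succ_of_ne_zero (Nat.sub_ne_zero_of_lt hq)
    rw [hn] at h
    exact K.rel_of_iterate_dMinus_ne_zero htrans hminus b n a h
  have hp (q : ℕ) (a b : K.B) (hq : q < K.dim a)
      (h : ((K.dPlus)^[K.dim a - q] (Finsupp.single a 1)) b ≠ 0) : r a b := by
    obtain ⟨n, hn⟩ := Nat.exists_eq_succ_of_ne_zero (Nat.sub_ne_zero_of_lt hq)
    rw [hn] at h
    exact K.rel_of_iterate_dPlus_ne_zero htrans hplus a n b h
  exact ⟨⟨hm, hp⟩, fun q => ⟨r, htrans, hirr, hm q, hp q⟩⟩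
end

section
/- Let K be a simple augmented directed complex and let a' and a'' be separated sequences of n-dimensional basis elements of K. Then a' ≤ a'' in the partial ordering of separated sequences if and only if there exists b ∈ K_{n+1}* with ∂b = a'' − a' (where a' and a'' are identified with the corresponding elements of K_n*). -/
/-- An ordered sequence of `n`-dimensional basis elements. -/
def OrderedSeq (G : GlobData) (n : ℕ) (l : List G.X) : Prop :=
  (∀ a ∈ l, G.dim a = n) ∧ l.Chain' G.le

/-- A separated sequence of `n`-dimensional basis elements: ordered, and each
consecutive pair of terms encloses a basis element of dimension `< n`. -/
def SeparatedSeq (G : GlobData) (n : ℕ) (l : List G.X) : Prop :=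
  OrderedSeq G n l ∧ l.Chain' (fun a b => ∃ c, G.lt a c ∧ G.lt c b ∧ G.dim c < n)

/-- The element of `K_n*` corresponding to a sequence of basis elements:
the sum of its terms. -/
noncomputable def chainOf (G : GlobData) (l : List G.X) : G.X →₀ ℤ :=
  (l.map fun a => Finsupp.single a (1 : ℤ)).sum

/-- The partial ordering of separated sequences of `n`-dimensional basis elements:
same length, termwise `≤`, and all basis elements strictly between corresponding
terms have dimension `≥ n`. -/
def sepLe (G : GlobData) (n : ℕ) (l l' : List G.X) : Prop :=
  List.Forall₂ (fun a a' => G.le a a' ∧ ∀ c, G.lt a c → G.lt c a' → n ≤ G.dim c) l l'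

namespace GlobData

open Relation

/-- The linear order on the elements of a simple globular set. -/
noncomputable abbrev linearOrder (G : GlobData) (h : IsSimpleGlobular G) : LinearOrder G.X where
  le := G.le
  lt := G.lt
  le_refl _ := Or.inr rfl
  le_trans a b c := by
    rintro (hab | rfl) (hbc | rfl)
    · exact Or.inl (TransGen.trans hab hbc)
    · exact Or.inl hab
    · exact Or.inl hbc
    · exact Or.inr rfl
  lt_iff_le_not_ge a b := by
    obtain ⟨-, -, -, -, -, -, hirr, -⟩ := h
    constructor
    · refine fun hab => ⟨Or.inl hab, ?_⟩
      rintro (hba | rfl)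
      · exact hirr _ (TransGen.trans hab hba)
      · exact hirr _ hab
    · rintro ⟨hab | rfl, hba⟩
      · exact hab
      · exact absurd (Or.inr rfl) hba
  le_antisymm a b := by
    obtain ⟨-, -, -, -, -, -, hirr, -⟩ := h
    rintro (hab | rfl) (hba | hba)
    · exact absurd (TransGen.trans hab hba) (hirr _)
    · exact hba.symm
    · rfl
    · rfl
  le_total a b := by
    obtain ⟨-, -, -, -, -, -, -, htot⟩ := h
    rcases htot a b with hab | rfl | hba
    · exact Or.inl (Or.inl hab)
    · exact Or.inl (Or.inr rfl)
    · exact Or.inr (Or.inl hba)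
  toDecidableLE := Classical.decRel _

variable {G : GlobData}

theorem src_lt {x : G.X} (hx : 0 < G.dim x) : G.lt (G.src x) x :=
  TransGen.single (Or.inl ⟨hx, rfl⟩)

theorem lt_tgt {x : G.X} (hx : 0 < G.dim x) : G.lt x (G.tgt x) :=
  TransGen.single (Or.inr ⟨hx, rfl⟩)

/-- The `k`-dimensional iterated source of `x`, if `k ≤ |x|`. -/
def srcAt (G : GlobData) (k : ℕ) (x : G.X) : G.X :=
  G.src^[G.dim x - k] x

/-- The `k`-dimensional iterated target of `x`, if `k ≤ |x|`. -/
def tgtAt (G : GlobData) (k : ℕ) (x : G.X) : G.X :=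
  G.tgt^[G.dim x - k] x

theorem srcAt_src (h : IsSimpleGlobular G) {k : ℕ} {x : G.X} (hk : k < G.dim x) :
    G.srcAt k (G.src x) = G.srcAt k x := by
  have hs := h.2.2.1 x (by omega)
  rw [srcAt, srcAt, show G.dim x - k = (G.dim (G.src x) - k) + 1 by omega,
    Function.iterate_succ_apply]

theorem tgtAt_tgt (h : IsSimpleGlobular G) {k : ℕ} {x : G.X} (hk : k < G.dim x) :
    G.tgtAt k (G.tgt x) = G.tgtAt k x := by
  have hs := h.2.2.2.1 x (by omega)
  rw [tgtAt, tgtAt, show G.dim x - k = (G.dim (G.tgt x) - k) + 1 by omega,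
    Function.iterate_succ_apply]

theorem srcAt_tgt (h : IsSimpleGlobular G) {k : ℕ} {x : G.X} (hk : k + 1 < G.dim x) :
    G.srcAt k (G.tgt x) = G.srcAt k x := by
  have hs := h.2.2.1 x (by omega)
  have ht := h.2.2.2.1 x (by omega)
  rw [← srcAt_src h (x := x) (by omega), ← srcAt_src h (x := G.src x) (by omega),
    ← srcAt_src h (x := G.tgt x) (by omega), h.2.2.2.2.1 x (by omega)]

theorem tgtAt_src (h : IsSimpleGlobular G) {k : ℕ} {x : G.X} (hk : k + 1 < G.dim x) :
    G.tgtAt k (G.src x) = G.tgtAt k x := by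
  have hs := h.2.2.1 x (by omega)
  have ht := h.2.2.2.1 x (by omega)
  rw [← tgtAt_tgt h (x := x) (by omega), ← tgtAt_tgt h (x := G.tgt x) (by omega),
    ← tgtAt_tgt h (x := G.src x) (by omega), h.2.2.2.2.2.1 x (by omega)]

theorem le_srcAt (h : IsSimpleGlobular G) {k : ℕ} {c x : G.X} (hcx : G.lt c x)
    (hc : G.dim c ≤ k) (hx : k < G.dim x) : G.le c (G.srcAt k x) := by
  have step : ∀ {z y : G.X}, G.rel z y → G.le c z → (k < G.dim z → G.le c (G.srcAt k z)) →
      k < G.dim y → G.le c (G.srcAt k y) := by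
    rintro z y (⟨hy, rfl⟩ | ⟨hz, rfl⟩) hcz ih hky
    · rw [← srcAt_src h hky]
      have hs := h.2.2.1 y hy
      rcases Nat.lt_or_ge k (G.dim (G.src y)) with hlt | hge
      · exact ih hlt
      · simpa [srcAt, Nat.sub_eq_zero_of_le hge] using hcz
    · have ht := h.2.2.2.1 z hz
      rw [srcAt_tgt h (by omega)]
      exact ih (by omega)
  induction hcx with
  | single hr => exact step hr (Or.inr rfl) (fun hk => absurd hk (by omega)) hx
  | tail hz hr ih => exact step hr (Or.inl hz) ih hx

theorem tgtAt_le (h : IsSimpleGlobular G) {k : ℕ} {c x : G.X} (hxc : G.lt x c)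
    (hc : G.dim c ≤ k) (hx : k < G.dim x) : G.le (G.tgtAt k x) c := by
  have step : ∀ {y z : G.X}, G.rel y z → G.le z c → (k < G.dim z → G.le (G.tgtAt k z) c) →
      k < G.dim y → G.le (G.tgtAt k y) c := by
    rintro y z (⟨hz, rfl⟩ | ⟨hy, rfl⟩) hcz ih hky
    · have hs := h.2.2.1 z hz
      rw [tgtAt_src h (by omega)]
      exact ih (by omega)
    · rw [← tgtAt_tgt h hky]
      have ht := h.2.2.2.1 y hy
      rcases Nat.lt_or_ge k (G.dim (G.tgt y)) with hlt | hge
      · exact ih hlt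
      · simpa [tgtAt, Nat.sub_eq_zero_of_le hge] using hcz
  induction hxc using TransGen.head_induction_on with
  | single hr => exact step hr (Or.inr rfl) (fun hk => absurd hk (by omega)) hx
  | head hr hz ih => exact step hr (Or.inl hz) ih hx

theorem le_src_of_lt (h : IsSimpleGlobular G) {c x : G.X} (hcx : G.lt c x)
    (hdim : G.dim c < G.dim x) : G.le c (G.src x) := by
  have hle := le_srcAt h (k := G.dim x - 1) hcx (by omega) (by omega)
  rwa [srcAt, show G.dim x - (G.dim x - 1) = 1 by omega] at hle

theorem tgt_le_of_lt (h : IsSimpleGlobular G) {c x : G.X} (hxc : G.lt x c)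
    (hdim : G.dim c < G.dim x) : G.le (G.tgt x) c := by
  have hle := tgtAt_le h (k := G.dim x - 1) hxc (by omega) (by omega)
  rwa [tgtAt, show G.dim x - (G.dim x - 1) = 1 by omega] at hle

/-- The boundary of `toADC` as a linear map. -/
theorem bnd_eq_linearCombination (G : GlobData) (b : G.X →₀ ℤ) :
    G.toADC.bnd b = Finsupp.linearCombination ℤ (fun x : G.X =>
      if 0 < G.dim x then (Finsupp.single (G.tgt x) 1 - Finsupp.single (G.src x) 1 : G.X →₀ ℤ)
      else 0) b := rfl

theorem bnd_zero (G : GlobData) : G.toADC.bnd (0 : G.X →₀ ℤ) = (0 : G.X →₀ ℤ) := by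
  rw [bnd_eq_linearCombination, map_zero]

theorem bnd_add (G : GlobData) (b c : G.X →₀ ℤ) :
    G.toADC.bnd (b + c : G.X →₀ ℤ) = (G.toADC.bnd b + G.toADC.bnd c : G.X →₀ ℤ) := by
  simp only [bnd_eq_linearCombination, map_add]
  rfl

theorem bnd_single {x : G.X} (hx : 0 < G.dim x) :
    G.toADC.bnd (Finsupp.single x 1 : G.X →₀ ℤ) =
      (Finsupp.single (G.tgt x) 1 - Finsupp.single (G.src x) 1 : G.X →₀ ℤ) := by
  rw [bnd_eq_linearCombination, Finsupp.linearCombination_single, one_smul, if_pos hx]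

/-- `x` is the boundary of a nonnegative chain of dimension `n + 1`. -/
def IsPosBoundary (G : GlobData) (n : ℕ) (x : G.X →₀ ℤ) : Prop :=
  ∃ b : G.X →₀ ℤ, (∀ c, 0 ≤ b c) ∧ (∀ c, b c ≠ 0 → G.dim c = n + 1) ∧ G.toADC.bnd b = x

theorem IsPosBoundary.zero (G : GlobData) (n : ℕ) : G.IsPosBoundary n 0 :=
  ⟨0, fun _ => le_rfl, fun _ hc => absurd rfl hc, G.bnd_zero⟩

theorem IsPosBoundary.add {n : ℕ} {x y : G.X →₀ ℤ} (hx : G.IsPosBoundary n x)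
    (hy : G.IsPosBoundary n y) : G.IsPosBoundary n (x + y) := by
  obtain ⟨b, hb, hbn, rfl⟩ := hx
  obtain ⟨c, hc, hcn, rfl⟩ := hy
  refine ⟨b + c, fun i => add_nonneg (hb i) (hc i), fun i hi => ?_, G.bnd_add b c⟩
  by_cases hbi : b i = 0
  · exact hcn i fun hci => hi (by simp [hbi, hci])
  · exact hbn i hbi

theorem isPosBoundary_tgt_sub_src {n : ℕ} {x : G.X} (hx : G.dim x = n + 1) :
    G.IsPosBoundary n (Finsupp.single (G.tgt x) 1 - Finsupp.single (G.src x) 1) := by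
  classical
  refine ⟨Finsupp.single x 1, fun c => ?_, fun c hc => ?_, bnd_single (by omega)⟩
  · rw [Finsupp.single_apply]
    split_ifs <;> simp
  · rw [Finsupp.single_apply] at hc
    split_ifs at hc with hxc
    · exact hxc ▸ hx
    · exact absurd rfl hc

theorem isPosBoundary_single_sub_single (h : IsSimpleGlobular G) {n : ℕ} {a a' : G.X}
    (ha : G.dim a = n) (ha' : G.dim a' = n) (hle : G.le a a')
    (hbetween : ∀ c, G.lt a c → G.lt c a' → n ≤ G.dim c) :
    G.IsPosBoundary n (Finsupp.single a' 1 - Finsupp.single a 1) := by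
  let := G.linearOrder h
  have := h.2.1
  induction a using WellFoundedGT.induction with
  | ind a ih =>
    rcases hle with hlt | rfl
    · obtain ⟨z, haz, hza'⟩ := TransGen.head'_iff.1 hlt
      have hlaz : G.lt a z := TransGen.single haz
      have hza' : G.le z a' := (reflTransGen_iff_eq_or_transGen.1 hza').elim
        (fun e => Or.inr e.symm) Or.inl
      rcases haz with ⟨hz, rfl⟩ | ⟨hpos, rfl⟩
      · have hs := h.2.2.1 z hz
        have ht := h.2.2.2.1 z hz
        have hlt' : G.lt z a' := by
          rcases hza' with hza' | rfl
          · exact hza'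
          · omega
        have hst : G.lt (G.src z) (G.tgt z) := TransGen.trans (src_lt hz) (lt_tgt hz)
        have hrest := ih (G.tgt z) hst (by omega) (tgt_le_of_lt h hlt' (by omega))
          fun c hc => hbetween c (TransGen.trans hst hc)
        have hsum := hrest.add (isPosBoundary_tgt_sub_src (x := z) (n := n) (by omega))
        rwa [sub_add_sub_cancel] at hsum
      · have ht := h.2.2.2.1 a hpos
        rcases hza' with hza' | rfl
        · have := hbetween _ hlaz hza'
          omega
        · omega
    · rw [sub_self]
      exact IsPosBoundary.zero G n

theorem chainOf_cons (G : GlobData) (a : G.X) (l : List G.X) :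
    chainOf G (a :: l) = Finsupp.single a 1 + chainOf G l := by
  simp [chainOf]

theorem linearCombination_chainOf (f : G.X → ℤ) (l : List G.X) :
    Finsupp.linearCombination ℤ f (chainOf G l) = (l.map f).sum := by
  induction l with
  | nil => simp [chainOf]
  | cons a l ih => simp [chainOf_cons, ih]

theorem isPosBoundary_of_sepLe (h : IsSimpleGlobular G) {n : ℕ} {l l' : List G.X}
    (hl : ∀ a ∈ l, G.dim a = n) (hl' : ∀ a ∈ l', G.dim a = n) (hle : sepLe G n l l') :
    G.IsPosBoundary n (chainOf G l' - chainOf G l) := by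
  induction hle with
  | nil => simpa using IsPosBoundary.zero G n
  | cons hab _ ih =>
    rw [chainOf_cons, chainOf_cons, add_sub_add_comm]
    simp only [List.forall_mem_cons] at hl hl'
    exact (isPosBoundary_single_sub_single h hl.1 hl'.1 hab.1 hab.2).add (ih hl.2 hl'.2)

theorem linearCombination_bnd (f : G.X → ℤ) {n : ℕ} {b : G.X →₀ ℤ}
    (hb : ∀ c, b c ≠ 0 → G.dim c = n + 1) :
    Finsupp.linearCombination ℤ f (G.toADC.bnd b) =
      ∑ z ∈ b.support, b z * (f (G.tgt z) - f (G.src z)) := by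
  rw [bnd_eq_linearCombination, Finsupp.apply_linearCombination,
    Finsupp.linearCombination_apply, Finsupp.sum]
  refine Finset.sum_congr rfl fun z hz => ?_
  have hdim := hb z (Finsupp.mem_support_iff.1 hz)
  simp [show 0 < G.dim z by omega]

end GlobData

/-- Two weakly increasing lists of equal length are compared termwise when the second never has
more terms below a threshold than the first; no threshold at which the two counts agree lies
strictly between corresponding terms. -/
theorem List.forall₂_of_countP_le {α : Type*} [LinearOrder α] (p : α → Prop) {l l' : List α}
    (hl : l.Pairwise (· ≤ ·)) (hl' : l'.Pairwise (· ≤ ·)) (hlen : l.length = l'.length)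
    (hle : ∀ t, l'.countP (· ≤ t) ≤ l.countP (· ≤ t))
    (heq : ∀ t, p t → l'.countP (· ≤ t) = l.countP (· ≤ t)) :
    List.Forall₂ (fun a a' => a ≤ a' ∧ ∀ c, a < c → c < a' → ¬ p c) l l' := by
  have hzero : ∀ {a t : α} {m : List α}, (∀ x ∈ m, a ≤ x) → t < a → m.countP (· ≤ t) = 0 := by
    intro a t m hm ht
    simp only [List.countP_eq_zero, decide_eq_true_eq, not_le]
    exact fun x hx => ht.trans_le (hm x hx)
  induction l generalizing l' with
  | nil =>
    obtain rfl := List.length_eq_zero_iff.1 hlen.symm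
    exact .nil
  | cons a l ih =>
    cases l' with
    | nil => simp at hlen
    | cons a' l' =>
      simp only [List.countP_cons, decide_eq_true_eq] at hle heq
      rw [List.pairwise_cons] at hl hl'
      have haa' : a ≤ a' := by
        by_contra! hlt
        have := hle a'
        rw [hzero hl.1 hlt, if_neg hlt.not_ge, if_pos le_rfl] at this
        omega
      have hgap : ∀ t, p t → a ≤ t → a' ≤ t := by
        intro t ht hat
        by_contra! hlt
        have := heq t ht
        rw [hzero hl'.1 hlt, if_neg hlt.not_ge, if_pos hat] at this
        omega
      refine .cons ⟨haa', fun c hac hca' hc => (hgap c hc hac.le).not_gt hca'⟩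
        (ih hl.2 hl'.2 (by simpa using hlen) (fun t => ?_) fun t ht => ?_)
      · rcases le_or_gt a' t with ha't | hlt
        · have := hle t
          rw [if_pos ha't, if_pos (haa'.trans ha't)] at this
          omega
        · rw [hzero hl'.1 hlt]
          exact Nat.zero_le _
      · have := heq t ht
        have hiff : a' ≤ t ↔ a ≤ t := ⟨haa'.trans, hgap t ht⟩
        simp only [hiff] at this
        omega

namespace GlobData

variable {G : GlobData}

theorem sepLe_of_isPosBoundary (h : IsSimpleGlobular G) {n : ℕ} {l l' : List G.X}
    (hl : OrderedSeq G n l) (hl' : OrderedSeq G n l')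
    (hb : G.IsPosBoundary n (chainOf G l' - chainOf G l)) : sepLe G n l l' := by
  let := G.linearOrder h
  obtain ⟨b, hpos, hdim, hbnd⟩ := hb
  have hsum (f : G.X → ℤ) : ∑ z ∈ b.support, b z * (f (G.tgt z) - f (G.src z)) =
      (l'.map f).sum - (l.map f).sum := by
    rw [← linearCombination_bnd f hdim, hbnd, map_sub, linearCombination_chainOf,
      linearCombination_chainOf]
  have hcount (t : G.X) (m : List G.X) :
      (m.map fun x => if x ≤ t then (1 : ℤ) else 0).sum = m.countP (· ≤ t) := by
    induction m with
    | nil => simp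
    | cons a m ih => simp [List.countP_cons, ih, add_comm]
  have hst {z : G.X} (hz : 0 < G.dim z) : G.src z ≤ G.tgt z :=
    (show G.src z < z from src_lt hz).le.trans (show z < G.tgt z from lt_tgt hz).le
  have hlen : l.length = l'.length := by
    have := hsum fun _ => 1
    simp at this
    omega
  have hle (t : G.X) : l'.countP (· ≤ t) ≤ l.countP (· ≤ t) := by
    have hnonpos := Finset.sum_nonpos (s := b.support)
      (f := fun z => b z * ((if G.tgt z ≤ t then (1 : ℤ) else 0) - if G.src z ≤ t then 1 else 0))
      fun z hz => by
        have hz' := hdim z (Finsupp.mem_support_iff.1 hz)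
        refine mul_nonpos_of_nonneg_of_nonpos (hpos z) ?_
        by_cases htt : G.tgt z ≤ t
        · simp [htt, (hst (by omega)).trans htt]
        · rw [if_neg htt]
          split_ifs <;> simp
    rw [hsum fun x => if x ≤ t then (1 : ℤ) else 0, hcount, hcount] at hnonpos
    omega
  have heq (t : G.X) (ht : G.dim t < n) : l'.countP (· ≤ t) = l.countP (· ≤ t) := by
    have hzero := Finset.sum_eq_zero (s := b.support)
      (f := fun z => b z * ((if G.tgt z ≤ t then (1 : ℤ) else 0) - if G.src z ≤ t then 1 else 0))
      fun z hz => by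
        have hz' := hdim z (Finsupp.mem_support_iff.1 hz)
        have hs := h.2.2.1 z (by omega)
        have hiff : G.tgt z ≤ t ↔ G.src z ≤ t := by
          refine ⟨(hst (by omega)).trans, fun hsrc => ?_⟩
          rcases lt_trichotomy z t with hzt | rfl | htz
          · exact tgt_le_of_lt h hzt (by omega)
          · omega
          · have htsrc : t ≤ G.src z := le_src_of_lt h htz (by omega)
            have := congrArg G.dim (le_antisymm htsrc hsrc)
            omega
        simp [hiff]
    rw [hsum fun x => if x ≤ t then (1 : ℤ) else 0, hcount, hcount] at hzero
    omega
  have hpw {m : List G.X} (hm : OrderedSeq G n m) : m.Pairwise (· ≤ ·) :=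
    List.isChain_iff_pairwise.1 hm.2
  exact (List.forall₂_of_countP_le (fun c => G.dim c < n) (hpw hl) (hpw hl') hlen hle heq).imp
    fun a a' haa' => ⟨haa'.1, fun c hac hca' => not_lt.1 (haa'.2 c hac hca')⟩

end GlobData

/-- For separated sequences `a'`, `a''` of `n`-dimensional basis elements of a
simple augmented directed complex, `a' ≤ a''` if and only if `a'' - a'` is the
boundary of a member of `K_{n+1}*`. -/
theorem stmt8 (G : GlobData) (h : IsSimpleGlobular G) (n : ℕ)
    (a' a'' : List G.X)
    (h' : SeparatedSeq G n a') (h'' : SeparatedSeq G n a'') :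
    sepLe G n a' a'' ↔
      ∃ b : G.X →₀ ℤ, (∀ c, 0 ≤ b c) ∧ (∀ c, b c ≠ 0 → G.dim c = n + 1) ∧
        G.toADC.bnd b = chainOf G a'' - chainOf G a' := by
  exact ⟨GlobData.isPosBoundary_of_sepLe h h'.1.1 h''.1.1,
    GlobData.sepLe_of_isPosBoundary h h'.1 h''.1⟩
end

section
/- Let K be a simple augmented directed complex, let a' ≤ a'' be separated sequences of n-dimensional basis elements of K, and let b be a sequence of (n+1)-dimensional basis elements bridging a' and a''. Then b is itself a separated sequence. -/
/-- `Interleaves G n x y b` says: if `A` is the (strictly increasing) enumeration of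
the `n`-dimensional basis elements `c` with `x ≤ c ≤ y`, then `b` interleaves `A`:
`b = (b_1, …, b_q)` with `A_{j-1} < b_j < A_j` for all `j`. -/
def Interleaves (G : GlobData) (n : ℕ) (x y : G.X) (b : List G.X) : Prop :=
  ∃ A : List G.X, A.Chain' G.lt ∧
    (∀ c, c ∈ A ↔ (G.dim c = n ∧ G.le x c ∧ G.le c y)) ∧
    List.Forall₂ (fun (pr : G.X × G.X) c => G.lt pr.1 c ∧ G.lt c pr.2) (A.zip A.tail) b

/-- A sequence `b` of `(n+1)`-dimensional basis elements bridges the separated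
sequences `a'` and `a''`: it is a concatenation of blocks, the `i`-th block
interleaving the `n`-dimensional elements between `a_i'` and `a_i''`. -/
def Bridges (G : GlobData) (n : ℕ) (a' a'' b : List G.X) : Prop :=
  a'.length = a''.length ∧
  (∀ c ∈ b, G.dim c = n + 1) ∧
  ∃ bs : List (List G.X), b = bs.flatten ∧
    List.Forall₂ (fun (pr : G.X × G.X) bi => Interleaves G n pr.1 pr.2 bi) (a'.zip a'') bs

namespace GlobData

theorem lt_of_le_of_lt {G : GlobData} {x y z : G.X} (h₁ : G.le x y) (h₂ : G.lt y z) :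
    G.lt x z := by
  rcases h₁ with h₁ | rfl
  · exact h₁.trans h₂
  · exact h₂

theorem lt_of_lt_of_le {G : GlobData} {x y z : G.X} (h₁ : G.lt x y) (h₂ : G.le y z) :
    G.lt x z := by
  rcases h₂ with h₂ | rfl
  · exact h₁.trans h₂
  · exact h₁

/-- `x < c < y` for some basis element `c` of dimension less than `n`. -/
def SepBelow (G : GlobData) (n : ℕ) (x y : G.X) : Prop :=
  ∃ c, G.lt x c ∧ G.lt c y ∧ G.dim c < n

theorem SepBelow.trans {G : GlobData} {n : ℕ} {x y z : G.X}
    (h₁ : G.SepBelow n x y) (h₂ : G.SepBelow n y z) : G.SepBelow n x z := by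
  obtain ⟨c, hxc, hcy, hc⟩ := h₁
  obtain ⟨d, hyd, hdz, -⟩ := h₂
  exact ⟨c, hxc, hcy.trans (hyd.trans hdz), hc⟩

instance (G : GlobData) (n : ℕ) : IsTrans G.X (G.SepBelow n) :=
  ⟨fun _ _ _ => SepBelow.trans⟩

theorem SepBelow.le {G : GlobData} {n : ℕ} {x y : G.X} (h : G.SepBelow n x y) : G.le x y := by
  obtain ⟨c, hxc, hcy, -⟩ := h
  exact Or.inl (hxc.trans hcy)

/-- A sequence interleaving a sequence `a :: l` of low-dimensional elements lies above `a` and is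
pairwise separated. -/
theorem pairwise_sepBelow_of_forall₂_zip {G : GlobData} {n : ℕ} {l b : List G.X} {a : G.X}
    (hl : ∀ c ∈ l, G.dim c < n)
    (h : List.Forall₂ (fun (p : G.X × G.X) c => G.lt p.1 c ∧ G.lt c p.2) ((a :: l).zip l) b) :
    (∀ x ∈ b, G.lt a x) ∧ b.Pairwise (G.SepBelow n) := by
  induction l generalizing a b with
  | nil => cases h; simp
  | cons a₂ l ih =>
    cases h with
    | cons h₁ hb =>
      obtain ⟨hlt, hpw⟩ := ih (fun c hc => hl c (List.mem_cons_of_mem _ hc)) hb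
      refine ⟨?_, List.pairwise_cons.2 ⟨fun x hx => ⟨a₂, h₁.2, hlt x hx, hl a₂ (by simp)⟩, hpw⟩⟩
      intro x hx
      rcases List.mem_cons.1 hx with rfl | hx
      · exact h₁.1
      · exact h₁.1.trans (h₁.2.trans (hlt x hx))

theorem exists_mem_of_forall₂ {α β : Type*} {R : α → β → Prop} {l : List α} {m : List β}
    (h : List.Forall₂ R l m) {y : β} (hy : y ∈ m) : ∃ x ∈ l, R x y := by
  induction h with
  | nil => simp at hy
  | cons h₁ _ ih =>
    rcases List.mem_cons.1 hy with rfl | hy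
    · exact ⟨_, by simp, h₁⟩
    · obtain ⟨x, hx, hxy⟩ := ih hy
      exact ⟨x, List.mem_cons_of_mem _ hx, hxy⟩

end GlobData

namespace Interleaves

theorem pairwise_sepBelow {G : GlobData} {n : ℕ} {x y : G.X} {b : List G.X}
    (h : Interleaves G n x y b) : b.Pairwise (G.SepBelow (n + 1)) := by
  obtain ⟨A, -, hA, hb⟩ := h
  cases A with
  | nil => cases hb; simp
  | cons a l =>
    refine (GlobData.pairwise_sepBelow_of_forall₂_zip (fun c hc => ?_) hb).2
    have := ((hA c).1 (List.mem_cons_of_mem _ hc)).1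
    omega

theorem lt_and_lt {G : GlobData} {n : ℕ} {x y : G.X} {b : List G.X}
    (h : Interleaves G n x y b) {c : G.X} (hc : c ∈ b) : G.lt x c ∧ G.lt c y := by
  obtain ⟨A, -, hA, hb⟩ := h
  obtain ⟨⟨p, q⟩, hpq, hpc, hcq⟩ := GlobData.exists_mem_of_forall₂ hb hc
  obtain ⟨hp, hq⟩ := List.of_mem_zip hpq
  exact ⟨GlobData.lt_of_le_of_lt ((hA p).1 hp).2.1 hpc,
    GlobData.lt_of_lt_of_le hcq ((hA q).1 (List.mem_of_mem_tail hq)).2.2⟩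

end Interleaves

/-- If `a'` is pairwise separated and `a' ≤ a''`, then the concatenation of blocks interleaving the
intervals between corresponding terms is pairwise separated. -/
theorem pairwise_sepBelow_flatten {G : GlobData}
    (htotal : ∀ x y, G.lt x y ∨ x = y ∨ G.lt y x) {n : ℕ} {a' a'' : List G.X}
    (hle : sepLe G n a' a'') (ha' : a'.Pairwise (G.SepBelow n)) {bs : List (List G.X)}
    (hbs : List.Forall₂ (fun (p : G.X × G.X) b => Interleaves G n p.1 p.2 b)
      (a'.zip a'') bs) :
    bs.flatten.Pairwise (G.SepBelow (n + 1)) := by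
  induction hle generalizing bs with
  | nil => cases hbs; simp
  | @cons x y l m hxy _ ih =>
    cases hbs with
    | @cons _ b _ bs hb hbs =>
      obtain ⟨hx, hl⟩ := List.pairwise_cons.1 ha'
      rw [List.flatten_cons, List.pairwise_append]
      refine ⟨hb.pairwise_sepBelow, ih hl hbs, fun u hu v hv => ?_⟩
      obtain ⟨b₂, hb₂, hv⟩ := List.mem_flatten.1 hv
      obtain ⟨⟨p, q⟩, hpq, hi⟩ := GlobData.exists_mem_of_forall₂ hbs hb₂
      obtain ⟨c, hxc, hcp, hc⟩ := hx p (List.of_mem_zip hpq).1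
      have hyc : G.le y c := by
        rcases htotal y c with h | h | h
        · exact Or.inl h
        · exact Or.inr h
        · exact absurd (hxy.2 c hxc h) (by omega)
      exact ⟨c, GlobData.lt_of_lt_of_le (hb.lt_and_lt hu).2 hyc,
        hcp.trans (hi.lt_and_lt hv).1, by omega⟩

/-- A sequence bridging two separated sequences is itself separated. -/
theorem stmt10 (G : GlobData) (h : IsSimpleGlobular G) (n : ℕ)
    (a' a'' : List G.X)
    (h' : SeparatedSeq G n a') (h'' : SeparatedSeq G n a'')
    (hle : sepLe G n a' a'')
    (b : List G.X) (hb : Bridges G n a' a'' b) :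
    SeparatedSeq G (n + 1) b := by
  obtain ⟨-, -, -, -, -, -, -, htotal⟩ := h
  obtain ⟨-, hdim, bs, rfl, hbs⟩ := hb
  have hpw : a'.Pairwise (G.SepBelow n) := List.isChain_iff_pairwise.1 h'.2
  have hchain := (pairwise_sepBelow_flatten htotal hle hpw hbs).isChain
  exact ⟨⟨hdim, hchain.imp fun _ _ => GlobData.SepBelow.le⟩, hchain⟩
end
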